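/- Let H be an infinite-dimensional separable complex Hilbert space. Then there exists an injective map φ: P(H) → P(H) with ‖φ(P) − φ(Q)‖ ≤ ‖P − Q‖ for all P, Q ∈ P(H) such that no linear or conjugate-linear isometry U: H → H satisfies φ(P) = UPU* for every P ∈ P(H). -/

import Mathlib

open scoped InnerProductSpace ComplexConjugate

variable {H : Type*} [NormedAddCommGroup H] [InnerProductSpace ℂ H] [CompleteSpace H]

/-- The rank-one (orthogonal) projection onto the span of a unit vector `v`,
i.e. `x ↦ ⟪v, x⟫ • v`. -/
noncomputable def rankOneProj (v : H) : H →L[ℂ] H :=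
  (innerSL ℂ v).smulRight v

/-- A rank-one projection: a self-adjoint idempotent bounded operator with
one-dimensional range. -/
def IsRankOneProjection (P : H →L[ℂ] H) : Prop :=
  IsSelfAdjoint P ∧ P ∘L P = P ∧ Module.finrank ℂ (LinearMap.range (P : H →ₗ[ℂ] H)) = 1

/-- A (not necessarily surjective) linear or conjugate-linear isometry `U : H → H`
implements `φ` if `φ(P) = U P U*` for every rank-one projection `P`; equivalently, `φ` sends
the projection onto `ℂv` to the projection onto `ℂ(Uv)` for every unit vector `v`. -/
def Implements (U : H → H)
    (φ : {P : H →L[ℂ] H // IsRankOneProjection P} → {P : H →L[ℂ] H // IsRankOneProjection P}) :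
    Prop :=
  (∀ x y, U (x + y) = U x + U y) ∧
  (∀ x, ‖U x‖ = ‖x‖) ∧
  ((∀ (c : ℂ) (x : H), U (c • x) = c • U x) ∨
    (∀ (c : ℂ) (x : H), U (c • x) = (starRingEnd ℂ) c • U x)) ∧
  (∀ (v : H), ‖v‖ = 1 → ∀ P : {P : H →L[ℂ] H // IsRankOneProjection P},
    P.1 = rankOneProj v → (φ P).1 = rankOneProj (U v))

theorem rankOneProj_apply (v x : H) : rankOneProj v x = ⟪v, x⟫_ℂ • v := by
  simp [rankOneProj]

theorem IsRankOneProjection.exists_unit {P : H →L[ℂ] H} (hP : IsRankOneProjection P) :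
    ∃ v : H, ‖v‖ = 1 ∧ P = rankOneProj v := by
  obtain ⟨hsa, hid, hr⟩ := hP
  have hsymm := hsa.isSymmetric
  obtain ⟨⟨w, hw⟩, hw0, hspan⟩ := finrank_eq_one_iff'.1 hr
  have hw0' : w ≠ 0 := fun h => hw0 (by simp [h])
  have hPw : P w = w := by
    obtain ⟨y, rfl⟩ := hw
    exact DFunLike.congr_fun hid y
  have hn : ‖w‖ ≠ 0 := norm_ne_zero_iff.2 hw0'
  refine ⟨((‖w‖⁻¹ : ℝ) : ℂ) • w, by simp [norm_smul, hn], ?_⟩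
  ext x
  obtain ⟨c, hc⟩ := hspan ⟨P x, x, rfl⟩
  have hc' : c • w = P x := congrArg Subtype.val hc
  have hin : ⟪w, x⟫_ℂ = c * ((‖w‖ : ℂ) ^ 2) := by
    have h1 : ⟪P w, x⟫_ℂ = ⟪w, P x⟫_ℂ := hsymm w x
    rw [hPw, ← hc', inner_smul_right, inner_self_eq_norm_sq_to_K] at h1
    simpa using h1
  have hn' : (‖w‖ : ℂ) ≠ 0 := by exact_mod_cast hn
  rw [rankOneProj_apply, inner_smul_left, hin, smul_smul, ← hc']
  congr 1
  rw [Complex.conj_ofReal, Complex.ofReal_inv]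
  field_simp

theorem isRankOneProjection_rankOneProj {v : H} (hv : ‖v‖ = 1) :
    IsRankOneProjection (rankOneProj v) := by
  have hvv : ⟪v, v⟫_ℂ = 1 := by simp [inner_self_eq_norm_sq_to_K, hv]
  have hv0 : v ≠ 0 := by rintro rfl; simp at hv
  refine ⟨?_, ?_, ?_⟩
  · rw [ContinuousLinearMap.isSelfAdjoint_iff_isSymmetric]
    intro x y
    simp [rankOneProj_apply, inner_smul_left, inner_smul_right, mul_comm]
  · ext x
    simp only [ContinuousLinearMap.comp_apply, rankOneProj_apply, inner_smul_right, hvv, mul_one]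
  · have hmem : v ∈ LinearMap.range (rankOneProj v : H →ₗ[ℂ] H) :=
      ⟨v, by rw [ContinuousLinearMap.coe_coe, rankOneProj_apply, hvv, one_smul]⟩
    refine finrank_eq_one_iff'.2 ⟨⟨v, hmem⟩, fun h => hv0 (congrArg Subtype.val h), ?_⟩
    rintro ⟨_, x, rfl⟩
    exact ⟨⟪v, x⟫_ℂ, Subtype.ext (by simp [rankOneProj_apply])⟩

/-- Nonnegativity of the Gram determinant of `u, v, x` for unit vectors `u, v`, read as a bound
for the difference of the two projections. -/
theorem norm_sq_rankOneProj_sub_apply_le {u v : H} (hu : ‖u‖ = 1) (hv : ‖v‖ = 1) (x : H) :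
    ‖rankOneProj u x - rankOneProj v x‖ ^ 2 ≤ (1 - ‖⟪u, v⟫_ℂ‖ ^ 2) * ‖x‖ ^ 2 := by
  have key := norm_inner_le_norm (𝕜 := ℂ) (x - ⟪u, x⟫_ℂ • u) (v - ⟪u, v⟫_ℂ • u)
  have key2 : ‖⟪x - ⟪u, x⟫_ℂ • u, v - ⟪u, v⟫_ℂ • u⟫_ℂ‖ ^ 2
      ≤ ‖x - ⟪u, x⟫_ℂ • u‖ ^ 2 * ‖v - ⟪u, v⟫_ℂ • u‖ ^ 2 := by
    rw [← mul_pow]; gcongr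
  have huu : ⟪u, u⟫_ℂ = 1 := by simp [inner_self_eq_norm_sq_to_K, hu]
  have hres (y : H) : ‖y - ⟪u, y⟫_ℂ • u‖ ^ 2 = ‖y‖ ^ 2 - ‖⟪u, y⟫_ℂ‖ ^ 2 := by
    rw [@norm_sub_sq ℂ, inner_smul_right, norm_smul, hu, ← inner_conj_symm y u, RCLike.mul_conj]
    norm_cast
    ring
  have hcross : ⟪x - ⟪u, x⟫_ℂ • u, v - ⟪u, v⟫_ℂ • u⟫_ℂ
      = conj ⟪v, x⟫_ℂ - conj ⟪u, x⟫_ℂ * ⟪u, v⟫_ℂ := by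
    simp only [inner_sub_left, inner_sub_right, inner_smul_left, inner_smul_right, huu,
      inner_conj_symm]
    ring
  have hlhs : ‖rankOneProj u x - rankOneProj v x‖ ^ 2 = ‖⟪u, x⟫_ℂ‖ ^ 2 + ‖⟪v, x⟫_ℂ‖ ^ 2
      - 2 * (conj ⟪u, x⟫_ℂ * ⟪v, x⟫_ℂ * ⟪u, v⟫_ℂ).re := by
    rw [rankOneProj_apply, rankOneProj_apply, @norm_sub_sq ℂ, inner_smul_left, inner_smul_right,
      norm_smul, norm_smul, hu, hv]
    simp only [RCLike.re_to_complex, mul_assoc]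
    ring
  rw [hcross, hres, hres, hv] at key2
  rw [hlhs]
  generalize ⟪u, x⟫_ℂ = a at *
  generalize ⟪v, x⟫_ℂ = b at *
  generalize ⟪u, v⟫_ℂ = t at *
  simp only [← Complex.normSq_eq_norm_sq, Complex.normSq_apply, Complex.mul_re, Complex.mul_im,
    Complex.sub_re, Complex.sub_im, Complex.conj_re, Complex.conj_im] at *
  nlinarith

theorem norm_sq_rankOneProj_sub {u v : H} (hu : ‖u‖ = 1) (hv : ‖v‖ = 1) :
    ‖rankOneProj u - rankOneProj v‖ ^ 2 = 1 - ‖⟪u, v⟫_ℂ‖ ^ 2 := by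
  have ht : 0 ≤ 1 - ‖⟪u, v⟫_ℂ‖ ^ 2 := by
    have := norm_inner_le_norm (𝕜 := ℂ) u v
    rw [hu, hv] at this
    nlinarith [norm_nonneg ⟪u, v⟫_ℂ]
  apply le_antisymm
  · rw [← Real.le_sqrt (norm_nonneg _) ht]
    refine ContinuousLinearMap.opNorm_le_bound _ (Real.sqrt_nonneg _) fun x => ?_
    refine (pow_le_pow_iff_left₀ (norm_nonneg _) (by positivity) two_ne_zero).1 ?_
    rw [mul_pow, Real.sq_sqrt ht]
    exact norm_sq_rankOneProj_sub_apply_le hu hv x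
  · have h := (rankOneProj u - rankOneProj v).le_opNorm u
    have huu : ⟪u, u⟫_ℂ = 1 := by simp [inner_self_eq_norm_sq_to_K, hu]
    have h2 : ‖(rankOneProj u - rankOneProj v) u‖ ^ 2 = 1 - ‖⟪u, v⟫_ℂ‖ ^ 2 := by
      rw [sub_apply, rankOneProj_apply, rankOneProj_apply, huu, one_smul,
        @norm_sub_sq ℂ, inner_smul_right, norm_smul, hu, hv, ← inner_conj_symm v u,
        RCLike.conj_mul, RCLike.norm_conj]
      norm_cast
      ring
    rw [hu, mul_one] at h
    rw [← h2]
    gcongr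

section TensorConj

variable {ι : Type*}

theorem lp.memℓp_mul_conj (f : lp (fun _ : ι => ℂ) 2) :
    Memℓp (fun p : ι × ι => f p.1 * conj (f p.2)) 2 := by
  have hf : Summable fun i => ‖f i‖ ^ 2 := by
    simpa using (lp.memℓp f).summable (by norm_num)
  refine memℓp_gen ?_
  simpa [mul_pow] using hf.mul_of_nonneg hf (fun _ => by positivity) fun _ => by positivity

/-- The element `f ⊗ f̄` of `ℓ²(ι × ι)`. -/
noncomputable def lp.mulConj (f : lp (fun _ : ι => ℂ) 2) : lp (fun _ : ι × ι => ℂ) 2 :=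
  ⟨fun p => f p.1 * conj (f p.2), lp.memℓp_mul_conj f⟩

theorem lp.mulConj_apply (f : lp (fun _ : ι => ℂ) 2) (p : ι × ι) :
    lp.mulConj f p = f p.1 * conj (f p.2) := rfl

theorem HasSum.eq_norm_sq_of_mul_conj {f : ι → ℂ} {s t : ℂ} (hf : HasSum f s)
    (h : HasSum (fun p : ι × ι => f p.1 * conj (f p.2)) t) : t = (‖s‖ : ℂ) ^ 2 := by
  have hf' : HasSum (fun i => conj (f i)) (conj s) := hf.star
  rw [← Complex.mul_conj']
  have hmul := hf.mul hf' h.summable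
  exact h.unique hmul

theorem lp.inner_mulConj (f g : lp (fun _ : ι => ℂ) 2) :
    ⟪lp.mulConj f, lp.mulConj g⟫_ℂ = (‖⟪f, g⟫_ℂ‖ : ℂ) ^ 2 := by
  refine (lp.hasSum_inner (𝕜 := ℂ) f g).eq_norm_sq_of_mul_conj ?_
  refine (lp.hasSum_inner (𝕜 := ℂ) (lp.mulConj f) (lp.mulConj g)).congr_fun fun p => ?_
  simp only [lp.mulConj_apply, RCLike.inner_apply, map_mul, Complex.conj_conj]
  ring

end TensorConj

theorem exists_infinite_hilbertBasis (hinf : ¬ FiniteDimensional ℂ H) :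
    ∃ (w : Set H) (_ : HilbertBasis w ℂ H), Infinite w := by
  obtain ⟨w, b, -⟩ := exists_hilbertBasis ℂ H
  refine ⟨w, b, not_finite_iff_infinite.1 fun _ => ?_⟩
  have := Fintype.ofFinite w
  exact hinf (Module.Finite.of_basis b.toOrthonormalBasis.toBasis)

/-- In infinite dimension the map `u ↦ (Ω ⊕ u ⊗ ū) / √2` can be realised inside `H` itself. -/
theorem exists_unit_map_inner (hinf : ¬ FiniteDimensional ℂ H) :
    ∃ G : H → H, ∀ u v : H, ⟪G u, G v⟫_ℂ = (((1 + ‖⟪u, v⟫_ℂ‖ ^ 2) / 2 : ℝ) : ℂ) := by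
  obtain ⟨w, b, _⟩ := exists_infinite_hilbertBasis hinf
  have hcard : Cardinal.mk (Option (w × w)) = Cardinal.mk w := by
    rw [Cardinal.mk_option, Cardinal.mk_prod, Cardinal.lift_id,
      Cardinal.mul_eq_self (Cardinal.aleph0_le_mk w),
      Cardinal.add_one_eq (Cardinal.aleph0_le_mk w)]
  obtain ⟨σ⟩ := Cardinal.eq.1 hcard
  have hE : Orthonormal ℂ (b ∘ σ) := b.orthonormal.comp σ σ.injective
  have hJ := (hE.comp some (Option.some_injective _)).orthogonalFamily
  set J := hJ.linearIsometry
  set Ω : H := b (σ none)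
  have hΩ : ⟪Ω, Ω⟫_ℂ = 1 := by
    simp [inner_self_eq_norm_sq_to_K, Ω, b.orthonormal.1]
  have hΩJ (f) : ⟪Ω, J f⟫_ℂ = 0 := by
    have h := (hJ.hasSum_linearIsometry f).mapL (innerSL ℂ Ω)
    refine h.unique ?_
    convert hasSum_zero using 2 with p
    have hp : ⟪Ω, b (σ (some p))⟫_ℂ = 0 := hE.2 (i := none) (j := some p) (by simp)
    simp [hp]
  have hJΩ (f) : ⟪J f, Ω⟫_ℂ = 0 := inner_eq_zero_symm.1 (hΩJ f)
  refine ⟨fun u => ((√2)⁻¹ : ℂ) • (Ω + J (lp.mulConj (b.repr u))), fun u v => ?_⟩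
  have hs : conj ((√2 : ℂ)⁻¹) * (√2 : ℂ)⁻¹ = 1 / 2 := by
    rw [map_inv₀, Complex.conj_ofReal, ← mul_inv, ← Complex.ofReal_mul]
    simp
  rw [inner_smul_left, inner_smul_right, ← mul_assoc, hs, inner_add_left, inner_add_right,
    inner_add_right, hΩ, hΩJ, hJΩ, J.inner_map_map, lp.inner_mulConj, b.repr.inner_map_map]
  push_cast
  ring

theorem Implements.inner_eq_zero {U : H → H}
    {φ : {P : H →L[ℂ] H // IsRankOneProjection P} → {P : H →L[ℂ] H // IsRankOneProjection P}}
    (h : Implements U φ) {v w : H} (hvw : ⟪v, w⟫_ℂ = 0) : ⟪U v, U w⟫_ℂ = 0 := by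
  obtain ⟨hadd, hnorm, hsmul, -⟩ := h
  have hre (x y : H) : (⟪U x, U y⟫_ℂ).re = (⟪x, y⟫_ℂ).re := by
    have h1 := @norm_add_sq ℂ _ _ _ _ (U x) (U y)
    rw [← hadd, hnorm, hnorm, hnorm, @norm_add_sq ℂ] at h1
    simp only [RCLike.re_to_complex] at h1
    linarith
  have h1 := hre v w
  have h2 := hre v (Complex.I • w)
  rw [inner_smul_right, hvw] at h2
  rw [hvw] at h1
  refine Complex.ext h1 ?_
  rcases hsmul with hs | hs <;> rw [hs, inner_smul_right] at h2 <;> simpa using h2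

/-- Example 4.2. If `H` is infinite-dimensional and separable, there is an
injective nonexpansive map `φ` of the set of rank-one projections that is not implemented by
any linear or conjugate-linear isometry `U : H → H`. -/
theorem exists_injective_nonexpansive_not_implemented
    [TopologicalSpace.SeparableSpace H]
    (hinf : ¬ FiniteDimensional ℂ H) :
    ∃ φ : {P : H →L[ℂ] H // IsRankOneProjection P} → {P : H →L[ℂ] H // IsRankOneProjection P},
      Function.Injective φ ∧
      (∀ P Q : {P : H →L[ℂ] H // IsRankOneProjection P},
        ‖(φ P).1 - (φ Q).1‖ ≤ ‖P.1 - Q.1‖) ∧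
      ¬ ∃ U : H → H, Implements U φ := by
  obtain ⟨G, hG⟩ := exists_unit_map_inner hinf
  have hG1 {u : H} (hu : ‖u‖ = 1) : ‖G u‖ = 1 := by
    have h := hG u u
    rw [inner_self_eq_norm_sq_to_K, inner_self_eq_norm_sq_to_K, hu] at h
    have h' : ‖G u‖ ^ 2 = 1 ^ 2 := by
      apply Complex.ofReal_injective
      push_cast
      simpa using h
    exact (pow_left_inj₀ (norm_nonneg _) zero_le_one two_ne_zero).1 h'
  choose r hr1 hr using fun P : {P : H →L[ℂ] H // IsRankOneProjection P} => P.2.exists_unit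
  have hdist (P Q : {P : H →L[ℂ] H // IsRankOneProjection P}) :
      ‖P.1 - Q.1‖ ^ 2 = 1 - ‖⟪r P, r Q⟫_ℂ‖ ^ 2 := by
    rw [hr P, hr Q, norm_sq_rankOneProj_sub (hr1 P) (hr1 Q)]
  have hφ (P Q : {P : H →L[ℂ] H // IsRankOneProjection P}) :
      ‖rankOneProj (G (r P)) - rankOneProj (G (r Q))‖ ^ 2
        = 1 - ((1 + ‖⟪r P, r Q⟫_ℂ‖ ^ 2) / 2) ^ 2 := by
    rw [norm_sq_rankOneProj_sub (hG1 (hr1 P)) (hG1 (hr1 Q)), hG, Complex.norm_real,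
      Real.norm_eq_abs, sq_abs]
  refine ⟨fun P => ⟨rankOneProj (G (r P)), isRankOneProjection_rankOneProj (hG1 (hr1 P))⟩,
    fun P Q hPQ => ?_, fun P Q => ?_, ?_⟩
  · have h := hφ P Q
    have hval : rankOneProj (G (r P)) = rankOneProj (G (r Q)) := congrArg Subtype.val hPQ
    rw [hval, sub_self, norm_zero] at h
    have ht : ‖⟪r P, r Q⟫_ℂ‖ ^ 2 = 1 := by nlinarith [sq_nonneg ‖⟪r P, r Q⟫_ℂ‖]
    have hd := hdist P Q
    rw [ht, sub_self, sq_eq_zero_iff, norm_eq_zero, sub_eq_zero] at hd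
    exact Subtype.ext hd
  · refine (pow_le_pow_iff_left₀ (norm_nonneg _) (norm_nonneg _) two_ne_zero).1 ?_
    rw [hφ, hdist]
    nlinarith [sq_nonneg (1 - ‖⟪r P, r Q⟫_ℂ‖ ^ 2)]
  · rintro ⟨U, hU⟩
    obtain ⟨v, w, hv, hw, hvw⟩ : ∃ v w : H, ‖v‖ = 1 ∧ ‖w‖ = 1 ∧ ⟪v, w⟫_ℂ = 0 := by
      obtain ⟨s, b, _⟩ := exists_infinite_hilbertBasis hinf
      obtain ⟨i, j, hij⟩ := exists_pair_ne s
      exact ⟨b i, b j, b.orthonormal.1 i, b.orthonormal.1 j, b.orthonormal.2 hij⟩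
    have hP := hU.2.2.2 v hv ⟨_, isRankOneProjection_rankOneProj hv⟩ rfl
    have hQ := hU.2.2.2 w hw ⟨_, isRankOneProjection_rankOneProj hw⟩ rfl
    have h := hφ ⟨_, isRankOneProjection_rankOneProj hv⟩ ⟨_, isRankOneProjection_rankOneProj hw⟩
    have hd := hdist ⟨_, isRankOneProjection_rankOneProj hv⟩
      ⟨_, isRankOneProjection_rankOneProj hw⟩
    rw [norm_sq_rankOneProj_sub hv hw, hvw] at hd
    simp only at hP hQ
    rw [hP, hQ, norm_sq_rankOneProj_sub ((hU.2.1 v).trans hv) ((hU.2.1 w).trans hw),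
      hU.inner_eq_zero hvw] at h
    rw [norm_zero] at h hd
    nlinarith
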